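/- arXiv:2110.08533 — 6 statements merged into one kernel-verified Lean document; each statement's English description precedes it below -/
import Mathlib

section
/- Let A₁,A₂,A₃,B₁,B₂,B₃,C ∈ ℝ² satisfy A₁+B₁ = A₂+B₂ = A₃+B₃ and condition (⋆). Then there exists a homeomorphism F from SU(3) onto the level set Φ⁻¹(C) ⊆ M ⊆ ℂ³×ℂ³ (with the subspace topology) which is T×T-equivariant in the following sense: for all diagonal unitary matrices g = diag(g₁,g₂,g₃) and h = diag(h₁,h₂,h₃) in SU(3) and all A ∈ SU(3), if F(A) = (z,w) then F(gAh⁻¹) = ((g₁h₁⁻¹z₁, g₂h₁⁻¹z₂, g₃h₁⁻¹z₃), (g₁⁻¹h₃w₁, g₂⁻¹h₃w₂, g₃⁻¹h₃w₃)). (This is the topological/equivariant content of Theorem 4.5, which asserts an equivariant diffeomorphism.) -/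
open scoped BigOperators Matrix

/-- `SU(3)`: the 3×3 complex matrices `A` with `A*A = 1` and `det A = 1`. -/
def SU3 : Set (Matrix (Fin 3) (Fin 3) ℂ) :=
  {A | A.conjTranspose * A = 1 ∧ A.det = 1}

/-- The quasi-affine variety `M ⊆ ℂ³ × ℂ³`. -/
def M : Set ((Fin 3 → ℂ) × (Fin 3 → ℂ)) :=
  {p | p.1 ≠ 0 ∧ p.2 ≠ 0 ∧ ∑ j, p.1 j * p.2 j = 0}

/-- The moment map `Φ(z,w) = Σⱼ (Aⱼ|zⱼ|² + Bⱼ|wⱼ|²)`. -/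
noncomputable def Phi (A B : Fin 3 → ℝ × ℝ) (p : (Fin 3 → ℂ) × (Fin 3 → ℂ)) : ℝ × ℝ :=
  ∑ j, (‖p.1 j‖ ^ 2 • A j + ‖p.2 j‖ ^ 2 • B j)

/-- The cone spanned by two vectors in `ℝ²`. -/
def cone2 (u v : ℝ × ℝ) : Set (ℝ × ℝ) :=
  {x | ∃ a b : ℝ, 0 ≤ a ∧ 0 ≤ b ∧ x = a • u + b • v}

/-- Condition (⋆). -/
def starCond (A B : Fin 3 → ℝ × ℝ) (C : ℝ × ℝ) : Prop :=
  (∀ i j : Fin 3, C ∉ cone2 (A i) (A j)) ∧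
  (∀ i j : Fin 3, C ∉ cone2 (B i) (B j)) ∧
  (∀ i j : Fin 3, C ∈ cone2 (A i) (B j))

/-- The determinant of a pair of vectors in `ℝ²`. -/
def det2 (u v : ℝ × ℝ) : ℝ := u.1 * v.2 - u.2 * v.1

/-- The weighted sum `Σⱼ Aⱼ|zⱼ|²`. -/
noncomputable def weightedSum (A : Fin 3 → ℝ × ℝ) (z : Fin 3 → ℂ) : ℝ × ℝ :=
  ∑ j, ‖z j‖ ^ 2 • A j

/-- The Hermitian norm on `ℂ³`. -/
noncomputable def hnorm (z : Fin 3 → ℂ) : ℝ := √(∑ j, ‖z j‖ ^ 2)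

/-- The square root of the coefficient of `P` when `C` is written in the basis `P, Q` (Cramer). -/
noncomputable def cramerLeft (P Q C : ℝ × ℝ) : ℝ := √(det2 C Q / det2 P Q)

/-- The square root of the coefficient of `Q` when `C` is written in the basis `P, Q` (Cramer). -/
noncomputable def cramerRight (P Q C : ℝ × ℝ) : ℝ := √(det2 P C / det2 P Q)

lemma mem_cone2_of_det2_eq_zero {A C : ℝ × ℝ} (h : det2 A C = 0)
    (hpos : 0 < A.1 * C.1 + A.2 * C.2) : C ∈ cone2 A A := by
  refine ⟨(C.1 ^ 2 + C.2 ^ 2) / (A.1 * C.1 + A.2 * C.2), 0, by positivity, le_rfl, ?_⟩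
  unfold det2 at h
  ext
  · simp only [zero_smul, add_zero, Prod.smul_fst, smul_eq_mul]
    rw [div_mul_eq_mul_div, eq_div_iff hpos.ne']
    linear_combination -C.2 * h
  · simp only [zero_smul, add_zero, Prod.smul_snd, smul_eq_mul]
    rw [div_mul_eq_mul_div, eq_div_iff hpos.ne']
    linear_combination C.1 * h

lemma mul_pos_trans {x y z : ℝ} (h₁ : 0 < x * y) (h₂ : 0 < y * z) : 0 < x * z := by
  rcases mul_pos_iff.1 h₁ with ⟨hx, hy⟩ | ⟨hx, hy⟩
  · exact mul_pos hx ((mul_pos_iff_of_pos_left hy).1 h₂)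
  · exact mul_pos_of_neg_of_neg hx (by nlinarith)

lemma det2_mul_pos {A B C : ℝ × ℝ} (hA : C ∉ cone2 A A) (hB : C ∉ cone2 B B)
    (hC : C ∈ cone2 A B) :
    0 < det2 A B * det2 C B ∧ 0 < det2 A B * det2 A C := by
  obtain ⟨a, b, ha, hb, rfl⟩ := hC
  have ha' : 0 < a := by
    refine lt_of_le_of_ne ha fun h => hB ⟨b, 0, hb, le_rfl, ?_⟩
    simp [← h]
  have hb' : 0 < b := by
    refine lt_of_le_of_ne hb fun h => hA ⟨a, 0, ha, le_rfl, ?_⟩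
    simp [← h]
  have h₁ : det2 (a • A + b • B) B = a * det2 A B := by simp [det2]; ring
  have h₂ : det2 A (a • A + b • B) = b * det2 A B := by simp [det2]; ring
  have hne : det2 A B ≠ 0 := by
    intro h0
    have hA' := mt (mem_cone2_of_det2_eq_zero (by rw [h₂, h0, mul_zero])) hA
    have hB' := mt (mem_cone2_of_det2_eq_zero (A := B) (C := a • A + b • B)
      (by rw [← neg_eq_zero, ← mul_zero a, ← h0, ← h₁]; simp [det2]; ring)) hB
    set C := a • A + b • B with hCdef
    have hC0 : C ≠ 0 := fun h => hA (h ▸ ⟨0, 0, le_rfl, le_rfl, by simp⟩)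
    have e₁ : C.1 = a * A.1 + b * B.1 := by simp [hCdef]
    have e₂ : C.2 = a * A.2 + b * B.2 := by simp [hCdef]
    have hsq : C.1 ^ 2 + C.2 ^ 2 =
        a * (A.1 * C.1 + A.2 * C.2) + b * (B.1 * C.1 + B.2 * C.2) := by
      linear_combination C.1 * e₁ + C.2 * e₂
    have hle : C.1 ^ 2 + C.2 ^ 2 ≤ 0 := by
      rw [hsq]
      nlinarith [not_lt.1 hA', not_lt.1 hB']
    apply hC0
    ext
    · simp; nlinarith [sq_nonneg C.1, sq_nonneg C.2]
    · simp; nlinarith [sq_nonneg C.1, sq_nonneg C.2]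
  have hp := mul_self_pos.2 hne
  rw [h₁, h₂]
  constructor
  · nlinarith [mul_pos ha' hp]
  · nlinarith [mul_pos hb' hp]

lemma starCond.exists_sign {A B : Fin 3 → ℝ × ℝ} {C : ℝ × ℝ} (h : starCond A B C) :
    ∃ ε : ℝ, (∀ i j, 0 < ε * det2 (A i) (B j)) ∧ (∀ j, 0 < ε * det2 C (B j)) ∧
      ∀ i, 0 < ε * det2 (A i) C := by
  obtain ⟨hA, hB, hC⟩ := h
  have key i j := det2_mul_pos (hA i i) (hB j j) (hC i j)
  have hCB : ∀ j, 0 < det2 (A 0) (B 0) * det2 C (B j) := fun j =>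
    mul_pos_trans (key 0 0).2 (mul_pos_trans (by rw [mul_comm]; exact (key 0 j).2) (key 0 j).1)
  have hAB : ∀ i j, 0 < det2 (A 0) (B 0) * det2 (A i) (B j) := fun i j =>
    mul_pos_trans (hCB j) (by rw [mul_comm]; exact (key i j).1)
  exact ⟨det2 (A 0) (B 0), hAB, hCB, fun i => mul_pos_trans (hAB i 0) (key i 0).2⟩

lemma det2_weightedSum_right (B : Fin 3 → ℝ × ℝ) (C : ℝ × ℝ) (w : Fin 3 → ℂ) :
    det2 C (weightedSum B w) = ∑ j, ‖w j‖ ^ 2 * det2 C (B j) := by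
  simp [det2, weightedSum, Fin.sum_univ_three]; ring

lemma det2_weightedSum_left (A : Fin 3 → ℝ × ℝ) (C : ℝ × ℝ) (z : Fin 3 → ℂ) :
    det2 (weightedSum A z) C = ∑ i, ‖z i‖ ^ 2 * det2 (A i) C := by
  simp [det2, weightedSum, Fin.sum_univ_three]; ring

lemma sum_norm_sq_mul_pos {z : Fin 3 → ℂ} (hz : z ≠ 0) {c : Fin 3 → ℝ} (hc : ∀ i, 0 < c i) :
    0 < ∑ i, ‖z i‖ ^ 2 * c i := by
  obtain ⟨i, hi⟩ := Function.ne_iff.1 hz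
  exact Finset.sum_pos' (fun j _ => mul_nonneg (sq_nonneg _) (hc j).le)
    ⟨i, Finset.mem_univ i, mul_pos (pow_pos (norm_pos_iff.2 hi) 2) (hc i)⟩

lemma starCond.det2_pos {A B : Fin 3 → ℝ × ℝ} {C : ℝ × ℝ} (h : starCond A B C) :
    ∃ ε : ℝ, ∀ z w : Fin 3 → ℂ, z ≠ 0 → w ≠ 0 →
      0 < ε * det2 (weightedSum A z) (weightedSum B w) ∧
      0 < ε * det2 C (weightedSum B w) ∧ 0 < ε * det2 (weightedSum A z) C := by
  obtain ⟨ε, hAB, hCB, hAC⟩ := h.exists_sign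
  have hw' : ∀ (D : ℝ × ℝ) (w : Fin 3 → ℂ), w ≠ 0 → (∀ j, 0 < ε * det2 D (B j)) →
      0 < ε * det2 D (weightedSum B w) := fun D w hw hD => by
    rw [det2_weightedSum_right, Finset.mul_sum]
    simpa only [mul_left_comm] using sum_norm_sq_mul_pos hw hD
  have hz' : ∀ (D : ℝ × ℝ) (z : Fin 3 → ℂ), z ≠ 0 → (∀ i, 0 < ε * det2 (A i) D) →
      0 < ε * det2 (weightedSum A z) D := fun D z hz hD => by
    rw [det2_weightedSum_left, Finset.mul_sum]
    simpa only [mul_left_comm] using sum_norm_sq_mul_pos hz hD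
  exact ⟨ε, fun z w hz hw =>
    ⟨hz' _ z hz fun i => hw' _ w hw (hAB i), hw' _ w hw hCB, hz' _ z hz hAC⟩⟩

lemma starCond.det2_ne_zero {A B : Fin 3 → ℝ × ℝ} {C : ℝ × ℝ} (h : starCond A B C)
    {z w : Fin 3 → ℂ} (hz : z ≠ 0) (hw : w ≠ 0) :
    det2 (weightedSum A z) (weightedSum B w) ≠ 0 := by
  obtain ⟨ε, hε⟩ := h.det2_pos
  exact right_ne_zero_of_mul (hε z w hz hw).1.ne'

lemma starCond.div_pos {A B : Fin 3 → ℝ × ℝ} {C : ℝ × ℝ} (h : starCond A B C)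
    {z w : Fin 3 → ℂ} (hz : z ≠ 0) (hw : w ≠ 0) :
    0 < det2 C (weightedSum B w) / det2 (weightedSum A z) (weightedSum B w) ∧
    0 < det2 (weightedSum A z) C / det2 (weightedSum A z) (weightedSum B w) := by
  obtain ⟨ε, hε⟩ := h.det2_pos
  obtain ⟨h₁, h₂, h₃⟩ := hε z w hz hw
  have hε0 : ε ≠ 0 := left_ne_zero_of_mul h₁.ne'
  rw [← mul_div_mul_left (det2 C _) _ hε0, ← mul_div_mul_left (det2 _ C) _ hε0]
  exact ⟨_root_.div_pos h₂ h₁, _root_.div_pos h₃ h₁⟩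

lemma weightedSum_smul (A : Fin 3 → ℝ × ℝ) (r : ℝ) (z : Fin 3 → ℂ) :
    weightedSum A (fun i => (r : ℂ) * z i) = r ^ 2 • weightedSum A z := by
  simp only [weightedSum, norm_mul, Complex.norm_real, mul_pow, mul_smul, Real.norm_eq_abs, sq_abs,
    Finset.smul_sum]

lemma weightedSum_congr (A : Fin 3 → ℝ × ℝ) {z w : Fin 3 → ℂ} (h : ∀ i, ‖z i‖ = ‖w i‖) :
    weightedSum A z = weightedSum A w := by
  simp only [weightedSum, h]

lemma Phi_eq (A B : Fin 3 → ℝ × ℝ) (p : (Fin 3 → ℂ) × (Fin 3 → ℂ)) :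
    Phi A B p = weightedSum A p.1 + weightedSum B p.2 :=
  Finset.sum_add_distrib

lemma cramer_smul_add {P Q C : ℝ × ℝ} (h : det2 P Q ≠ 0) :
    (det2 C Q / det2 P Q) • P + (det2 P C / det2 P Q) • Q = C := by
  ext
  · simp
    field_simp
    simp only [det2]; ring
  · simp
    field_simp
    simp only [det2]; ring

lemma det2_smul_smul (a b : ℝ) (P Q : ℝ × ℝ) : det2 (a • P) (b • Q) = a * b * det2 P Q := by
  simp [det2]; ring

lemma cramerLeft_smul_add {P Q : ℝ × ℝ} {r s : ℝ} (hr : 0 < r) (hs : 0 < s) (h : det2 P Q ≠ 0) :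
    cramerLeft (r⁻¹ ^ 2 • P) (s⁻¹ ^ 2 • Q) (P + Q) = r := by
  have hPQ : det2 (P + Q) (s⁻¹ ^ 2 • Q) = s⁻¹ ^ 2 * det2 P Q := by simp [det2]; ring
  rw [cramerLeft, hPQ, det2_smul_smul,
    show s⁻¹ ^ 2 * det2 P Q / (r⁻¹ ^ 2 * s⁻¹ ^ 2 * det2 P Q) = r ^ 2 by field_simp,
    Real.sqrt_sq hr.le]

lemma cramerRight_smul_add {P Q : ℝ × ℝ} {r s : ℝ} (hr : 0 < r) (hs : 0 < s) (h : det2 P Q ≠ 0) :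
    cramerRight (r⁻¹ ^ 2 • P) (s⁻¹ ^ 2 • Q) (P + Q) = s := by
  have hPQ : det2 (r⁻¹ ^ 2 • P) (P + Q) = r⁻¹ ^ 2 * det2 P Q := by simp [det2]; ring
  rw [cramerRight, hPQ, det2_smul_smul,
    show r⁻¹ ^ 2 * det2 P Q / (r⁻¹ ^ 2 * s⁻¹ ^ 2 * det2 P Q) = s ^ 2 by field_simp,
    Real.sqrt_sq hs.le]

lemma hnorm_sq (z : Fin 3 → ℂ) : hnorm z ^ 2 = ∑ j, ‖z j‖ ^ 2 :=
  Real.sq_sqrt (by positivity)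

lemma hnorm_pos {z : Fin 3 → ℂ} (hz : z ≠ 0) : 0 < hnorm z :=
  Real.sqrt_pos.2 (by simpa using sum_norm_sq_mul_pos hz fun _ => one_pos)

lemma hnorm_real_mul {r : ℝ} (hr : 0 ≤ r) (z : Fin 3 → ℂ) :
    hnorm (fun i => (r : ℂ) * z i) = r * hnorm z := by
  simp only [hnorm, norm_mul, Complex.norm_real, mul_pow, Real.norm_eq_abs, sq_abs,
    ← Finset.mul_sum]
  rw [Real.sqrt_mul (sq_nonneg r), Real.sqrt_sq hr]

lemma continuous_weightedSum (A : Fin 3 → ℝ × ℝ) : Continuous (weightedSum A) := by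
  unfold weightedSum; fun_prop

lemma continuous_hnorm : Continuous hnorm := by
  unfold hnorm; fun_prop

lemma continuous_det2 : Continuous fun p : (ℝ × ℝ) × (ℝ × ℝ) => det2 p.1 p.2 := by
  unfold det2; fun_prop

/-- The first column of a matrix. -/
def firstCol (X : Matrix (Fin 3) (Fin 3) ℂ) : Fin 3 → ℂ := fun i => X i 0

/-- The complex conjugate of the last column of a matrix. -/
def lastColConj (X : Matrix (Fin 3) (Fin 3) ℂ) : Fin 3 → ℂ := fun i => star (X i 2)

/-- The matrix whose first column is `u`, whose last column is the conjugate of `v`, and whose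
middle column is the cross product of `v` and the conjugate of `u`. -/
def frame (u v : Fin 3 → ℂ) : Matrix (Fin 3) (Fin 3) ℂ :=
  !![u 0, v 1 * star (u 2) - v 2 * star (u 1), star (v 0);
     u 1, v 2 * star (u 0) - v 0 * star (u 2), star (v 1);
     u 2, v 0 * star (u 1) - v 1 * star (u 0), star (v 2)]

lemma firstCol_frame (u v : Fin 3 → ℂ) : firstCol (frame u v) = u := by
  ext i; fin_cases i <;> rfl

lemma lastColConj_frame (u v : Fin 3 → ℂ) : lastColConj (frame u v) = v := by
  ext i; fin_cases i <;> simp [lastColConj, frame]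

lemma sum_star_mul_self (u : Fin 3 → ℂ) : ∑ j, star (u j) * u j = ((hnorm u ^ 2 : ℝ) : ℂ) := by
  rw [hnorm_sq]
  push_cast
  exact Finset.sum_congr rfl fun j _ => Complex.conj_mul' (u j)

lemma frame_mem_SU3 {u v : Fin 3 → ℂ} (hu : hnorm u = 1) (hv : hnorm v = 1)
    (huv : ∑ j, u j * v j = 0) : frame u v ∈ SU3 := by
  have hu' := sum_star_mul_self u
  have hv' := sum_star_mul_self v
  have huv' := congrArg star huv
  simp only [hu, hv, Fin.sum_univ_three, star_add, star_mul', star_zero, one_pow,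
    Complex.ofReal_one] at hu' hv' huv huv'
  constructor
  · ext i j
    fin_cases i <;> fin_cases j <;>
      simp [frame, Matrix.mul_apply, Fin.sum_univ_three] <;>
      simp only [Complex.star_def] at hu' hv' huv huv'
    · linear_combination hu'
    · ring
    · linear_combination huv'
    · ring
    · linear_combination (v 0 * starRingEnd ℂ (v 0) + v 1 * starRingEnd ℂ (v 1) +
        v 2 * starRingEnd ℂ (v 2)) * hu' + hv' - (starRingEnd ℂ (u 0) * starRingEnd ℂ (v 0) +
        starRingEnd ℂ (u 1) * starRingEnd ℂ (v 1) + starRingEnd ℂ (u 2) * starRingEnd ℂ (v 2)) * huv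
    · ring
    · linear_combination huv
    · ring
    · linear_combination hv'
  · rw [Matrix.det_fin_three]
    simp [frame]
    simp only [Complex.star_def] at hu' hv' huv huv'
    linear_combination (v 0 * starRingEnd ℂ (v 0) + v 1 * starRingEnd ℂ (v 1) +
        v 2 * starRingEnd ℂ (v 2)) * hu' + hv' - (starRingEnd ℂ (u 0) * starRingEnd ℂ (v 0) +
        starRingEnd ℂ (u 1) * starRingEnd ℂ (v 1) + starRingEnd ℂ (u 2) * starRingEnd ℂ (v 2)) * huv

lemma frame_firstCol_lastColConj {X : Matrix (Fin 3) (Fin 3) ℂ} (hX : X ∈ SU3) :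
    frame (firstCol X) (lastColConj X) = X := by
  have hadj : X.adjugate = X.conjTranspose := by
    calc X.adjugate = X.conjTranspose * X * X.adjugate := by rw [hX.1, one_mul]
      _ = X.conjTranspose := by rw [mul_assoc, Matrix.mul_adjugate, hX.2, one_smul, mul_one]
  have hcol (i : Fin 3) : star (X.adjugate 1 i) = X i 1 := by
    rw [hadj, Matrix.conjTranspose_apply, star_star]
  rw [Matrix.adjugate_fin_three] at hcol
  have h0 := hcol 0
  have h1 := hcol 1
  have h2 := hcol 2
  simp at h0 h1 h2
  ext i j
  fin_cases i <;> fin_cases j <;> simp [frame, firstCol, lastColConj]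
  · rw [← h0]; ring
  · rw [← h1]; ring
  · rw [← h2]; ring

lemma hnorm_firstCol {X : Matrix (Fin 3) (Fin 3) ℂ} (hX : X ∈ SU3) : hnorm (firstCol X) = 1 := by
  have h := congrFun (congrFun hX.1 0) 0
  have h' := sum_star_mul_self (firstCol X)
  rw [Matrix.mul_apply, Matrix.one_apply_eq] at h
  simp only [Matrix.conjTranspose_apply] at h
  rw [show ∑ j, star (firstCol X j) * firstCol X j = 1 from h] at h'
  exact (pow_eq_one_iff_of_nonneg (Real.sqrt_nonneg _) two_ne_zero).1 (by exact_mod_cast h'.symm)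

lemma hnorm_lastColConj {X : Matrix (Fin 3) (Fin 3) ℂ} (hX : X ∈ SU3) :
    hnorm (lastColConj X) = 1 := by
  have h := congrFun (congrFun hX.1 2) 2
  have h' := sum_star_mul_self (lastColConj X)
  rw [Matrix.mul_apply, Matrix.one_apply_eq] at h
  simp only [Matrix.conjTranspose_apply] at h
  have e : ∑ j, star (lastColConj X j) * lastColConj X j = 1 := by
    rw [← h]
    exact Finset.sum_congr rfl fun j _ => by simp [lastColConj, mul_comm]
  rw [e] at h'
  exact (pow_eq_one_iff_of_nonneg (Real.sqrt_nonneg _) two_ne_zero).1 (by exact_mod_cast h'.symm)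

lemma sum_firstCol_mul_lastColConj {X : Matrix (Fin 3) (Fin 3) ℂ} (hX : X ∈ SU3) :
    ∑ j, firstCol X j * lastColConj X j = 0 := by
  have h := congrFun (congrFun hX.1 2) 0
  rw [Matrix.mul_apply, Matrix.one_apply_ne (by decide)] at h
  rw [← h]
  exact Finset.sum_congr rfl fun j _ => mul_comm _ _

lemma ne_zero_of_hnorm_eq_one {z : Fin 3 → ℂ} (h : hnorm z = 1) : z ≠ 0 := by
  rintro rfl
  simp [hnorm] at h

/-- The scaling factor of the first column. -/
noncomputable def scaleLeft (A B : Fin 3 → ℝ × ℝ) (C : ℝ × ℝ) (z w : Fin 3 → ℂ) : ℝ :=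
  cramerLeft (weightedSum A z) (weightedSum B w) C

/-- The scaling factor of the conjugate of the last column. -/
noncomputable def scaleRight (A B : Fin 3 → ℝ × ℝ) (C : ℝ × ℝ) (z w : Fin 3 → ℂ) : ℝ :=
  cramerRight (weightedSum A z) (weightedSum B w) C

/-- The pair on the `(ℝ₊)²`-orbit of `(z, w)` that lies on the level set of `C`. -/
noncomputable def rescale (A B : Fin 3 → ℝ × ℝ) (C : ℝ × ℝ) (z w : Fin 3 → ℂ) :
    (Fin 3 → ℂ) × (Fin 3 → ℂ) :=
  (fun i => (scaleLeft A B C z w : ℂ) * z i, fun i => (scaleRight A B C z w : ℂ) * w i)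

lemma starCond.scale_pos {A B : Fin 3 → ℝ × ℝ} {C : ℝ × ℝ} (h : starCond A B C)
    {z w : Fin 3 → ℂ} (hz : z ≠ 0) (hw : w ≠ 0) :
    0 < scaleLeft A B C z w ∧ 0 < scaleRight A B C z w :=
  ⟨Real.sqrt_pos.2 (h.div_pos hz hw).1, Real.sqrt_pos.2 (h.div_pos hz hw).2⟩

lemma real_mul_ne_zero {r : ℝ} (hr : r ≠ 0) {z : Fin 3 → ℂ} (hz : z ≠ 0) :
    (fun i => (r : ℂ) * z i) ≠ 0 := by
  obtain ⟨i, hi⟩ := Function.ne_iff.1 hz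
  exact Function.ne_iff.2 ⟨i, mul_ne_zero (Complex.ofReal_ne_zero.2 hr) hi⟩

lemma sum_real_mul_mul_real_mul (r s : ℝ) (z w : Fin 3 → ℂ) :
    ∑ j, ((r : ℂ) * z j) * ((s : ℂ) * w j) = r * s * ∑ j, z j * w j := by
  rw [Finset.mul_sum]
  exact Finset.sum_congr rfl fun j _ => by ring

lemma starCond.rescale_mem {A B : Fin 3 → ℝ × ℝ} {C : ℝ × ℝ} (h : starCond A B C)
    {z w : Fin 3 → ℂ} (hz : z ≠ 0) (hw : w ≠ 0) (hzw : ∑ j, z j * w j = 0) :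
    rescale A B C z w ∈ M ∧ Phi A B (rescale A B C z w) = C := by
  obtain ⟨hs, ht⟩ := h.scale_pos hz hw
  refine ⟨⟨real_mul_ne_zero hs.ne' hz, real_mul_ne_zero ht.ne' hw, ?_⟩, ?_⟩
  · simp only [rescale, sum_real_mul_mul_real_mul, hzw, mul_zero]
  · rw [Phi_eq, rescale, weightedSum_smul, weightedSum_smul, scaleLeft, scaleRight, cramerLeft,
      cramerRight, Real.sq_sqrt (h.div_pos hz hw).1.le, Real.sq_sqrt (h.div_pos hz hw).2.le]
    exact cramer_smul_add (h.det2_ne_zero hz hw)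

/-- The unit vector in the direction of `z`. -/
noncomputable def unitVec (z : Fin 3 → ℂ) : Fin 3 → ℂ := fun i => (((hnorm z)⁻¹ : ℝ) : ℂ) * z i

lemma hnorm_unitVec {z : Fin 3 → ℂ} (hz : z ≠ 0) : hnorm (unitVec z) = 1 := by
  unfold unitVec
  rw [hnorm_real_mul (inv_nonneg.2 (hnorm_pos hz).le), inv_mul_cancel₀ (hnorm_pos hz).ne']

lemma unitVec_real_mul {r : ℝ} (hr : 0 < r) {z : Fin 3 → ℂ} (hz : hnorm z = 1) :
    unitVec (fun i => (r : ℂ) * z i) = z := by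
  ext i
  rw [unitVec, hnorm_real_mul hr.le, hz, mul_one, ← mul_assoc, ← Complex.ofReal_mul,
    inv_mul_cancel₀ hr.ne', Complex.ofReal_one, one_mul]

lemma weightedSum_unitVec (A : Fin 3 → ℝ × ℝ) (z : Fin 3 → ℂ) :
    weightedSum A (unitVec z) = (hnorm z)⁻¹ ^ 2 • weightedSum A z :=
  weightedSum_smul A _ z

lemma frame_unitVec_mem_SU3 {p : (Fin 3 → ℂ) × (Fin 3 → ℂ)} (hp : p ∈ M) :
    frame (unitVec p.1) (unitVec p.2) ∈ SU3 := by
  refine frame_mem_SU3 (hnorm_unitVec hp.1) (hnorm_unitVec hp.2.1) ?_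
  simp only [unitVec, sum_real_mul_mul_real_mul, hp.2.2, mul_zero]

lemma starCond.rescale_unitVec {A B : Fin 3 → ℝ × ℝ} {C : ℝ × ℝ} (h : starCond A B C)
    {p : (Fin 3 → ℂ) × (Fin 3 → ℂ)} (hp : p ∈ M) (hC : Phi A B p = C) :
    rescale A B C (unitVec p.1) (unitVec p.2) = p := by
  have hd := h.det2_ne_zero hp.1 hp.2.1
  have hr := hnorm_pos hp.1
  have hs := hnorm_pos hp.2.1
  have hl : scaleLeft A B C (unitVec p.1) (unitVec p.2) = hnorm p.1 := by
    rw [scaleLeft, weightedSum_unitVec, weightedSum_unitVec, ← hC, Phi_eq,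
      cramerLeft_smul_add hr hs hd]
  have ht : scaleRight A B C (unitVec p.1) (unitVec p.2) = hnorm p.2 := by
    rw [scaleRight, weightedSum_unitVec, weightedSum_unitVec, ← hC, Phi_eq,
      cramerRight_smul_add hr hs hd]
  rw [rescale, hl, ht]
  have hr' : (hnorm p.1 : ℂ) ≠ 0 := Complex.ofReal_ne_zero.2 hr.ne'
  have hs' : (hnorm p.2 : ℂ) ≠ 0 := Complex.ofReal_ne_zero.2 hs.ne'
  ext i <;> simp [unitVec, hr', hs']

lemma starCond.rescale_cols_mem {A B : Fin 3 → ℝ × ℝ} {C : ℝ × ℝ} (h : starCond A B C)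
    {X : Matrix (Fin 3) (Fin 3) ℂ} (hX : X ∈ SU3) :
    rescale A B C (firstCol X) (lastColConj X) ∈ M ∧
      Phi A B (rescale A B C (firstCol X) (lastColConj X)) = C :=
  h.rescale_mem (ne_zero_of_hnorm_eq_one (hnorm_firstCol hX))
    (ne_zero_of_hnorm_eq_one (hnorm_lastColConj hX)) (sum_firstCol_mul_lastColConj hX)

lemma continuous_firstCol : Continuous firstCol := by
  unfold firstCol; fun_prop

lemma continuous_lastColConj : Continuous lastColConj := by
  unfold lastColConj; fun_prop

lemma continuous_frame :
    Continuous fun p : (Fin 3 → ℂ) × (Fin 3 → ℂ) => frame p.1 p.2 := by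
  refine continuous_matrix fun i j => ?_
  fin_cases i <;> fin_cases j <;> simp [frame] <;> fun_prop

lemma continuousOn_unitVec : ContinuousOn unitVec {z | z ≠ 0} := by
  unfold unitVec
  refine continuousOn_pi.2 fun i => ContinuousOn.mul ?_ (continuous_apply i).continuousOn
  exact Complex.continuous_ofReal.comp_continuousOn
    (continuous_hnorm.continuousOn.inv₀ fun z hz => (hnorm_pos hz).ne')

lemma starCond.continuousOn_rescale {A B : Fin 3 → ℝ × ℝ} {C : ℝ × ℝ} (h : starCond A B C) :
    ContinuousOn (fun p : (Fin 3 → ℂ) × (Fin 3 → ℂ) => rescale A B C p.1 p.2)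
      {p | p.1 ≠ 0 ∧ p.2 ≠ 0} := by
  have hP := (continuous_weightedSum A).comp
    (continuous_fst (X := Fin 3 → ℂ) (Y := Fin 3 → ℂ))
  have hQ := (continuous_weightedSum B).comp
    (continuous_snd (X := Fin 3 → ℂ) (Y := Fin 3 → ℂ))
  have hl : ContinuousOn (fun p : (Fin 3 → ℂ) × (Fin 3 → ℂ) => scaleLeft A B C p.1 p.2)
      {p | p.1 ≠ 0 ∧ p.2 ≠ 0} :=
    Real.continuous_sqrt.comp_continuousOn <| ContinuousOn.div
      (continuous_det2.comp (continuous_const.prodMk hQ)).continuousOn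
      (continuous_det2.comp (hP.prodMk hQ)).continuousOn
      fun p hp => h.det2_ne_zero hp.1 hp.2
  have hr : ContinuousOn (fun p : (Fin 3 → ℂ) × (Fin 3 → ℂ) => scaleRight A B C p.1 p.2)
      {p | p.1 ≠ 0 ∧ p.2 ≠ 0} :=
    Real.continuous_sqrt.comp_continuousOn <| ContinuousOn.div
      (continuous_det2.comp (hP.prodMk continuous_const)).continuousOn
      (continuous_det2.comp (hP.prodMk hQ)).continuousOn
      fun p hp => h.det2_ne_zero hp.1 hp.2
  refine ContinuousOn.prodMk (continuousOn_pi.2 fun i => ?_) (continuousOn_pi.2 fun i => ?_)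
  · exact (Complex.continuous_ofReal.comp_continuousOn hl).mul (by fun_prop)
  · exact (Complex.continuous_ofReal.comp_continuousOn hr).mul (by fun_prop)

/-- The homeomorphism from `SU(3)` onto the level set of `C`. -/
noncomputable def starCond.homeomorph {A B : Fin 3 → ℝ × ℝ} {C : ℝ × ℝ} (h : starCond A B C) :
    SU3 ≃ₜ {p : (Fin 3 → ℂ) × (Fin 3 → ℂ) // p ∈ M ∧ Phi A B p = C} where
  toFun X := ⟨rescale A B C (firstCol X) (lastColConj X), h.rescale_cols_mem X.2⟩
  invFun p := ⟨frame (unitVec p.1.1) (unitVec p.1.2), frame_unitVec_mem_SU3 p.2.1⟩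
  left_inv X := by
    have hu := hnorm_firstCol X.2
    have hv := hnorm_lastColConj X.2
    obtain ⟨hs, ht⟩ := h.scale_pos (ne_zero_of_hnorm_eq_one hu) (ne_zero_of_hnorm_eq_one hv)
    ext1
    simp only [rescale, unitVec_real_mul hs hu, unitVec_real_mul ht hv]
    exact frame_firstCol_lastColConj X.2
  right_inv p := by
    ext1
    simp only [firstCol_frame, lastColConj_frame]
    exact h.rescale_unitVec p.2.1 p.2.2
  continuous_toFun := by
    refine Continuous.subtype_mk (h.continuousOn_rescale.comp_continuous
      (f := fun X : SU3 => (firstCol X.1, lastColConj X.1)) ?_ fun X => ?_) _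
    · exact (continuous_firstCol.comp continuous_subtype_val).prodMk
        (continuous_lastColConj.comp continuous_subtype_val)
    · exact ⟨ne_zero_of_hnorm_eq_one (hnorm_firstCol X.2),
        ne_zero_of_hnorm_eq_one (hnorm_lastColConj X.2)⟩
  continuous_invFun := by
    have hfst := continuousOn_unitVec.comp_continuous
      (f := fun p : {p : (Fin 3 → ℂ) × (Fin 3 → ℂ) // p ∈ M ∧ Phi A B p = C} => p.1.1)
      (by fun_prop) fun p => p.2.1.1
    have hsnd := continuousOn_unitVec.comp_continuous
      (f := fun p : {p : (Fin 3 → ℂ) × (Fin 3 → ℂ) // p ∈ M ∧ Phi A B p = C} => p.1.2)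
      (by fun_prop) fun p => p.2.1.2.1
    exact Continuous.subtype_mk (continuous_frame.comp (hfst.prodMk hsnd)) _

lemma diagonal_mul_mul_inv_diagonal_apply {g h : Fin 3 → ℂ} (hh : ∀ i, h i ≠ 0)
    (X : Matrix (Fin 3) (Fin 3) ℂ) (i j : Fin 3) :
    (Matrix.diagonal g * X * (Matrix.diagonal h)⁻¹) i j = g i * X i j * (h j)⁻¹ := by
  have hinv : (Matrix.diagonal h)⁻¹ = Matrix.diagonal fun i => (h i)⁻¹ :=
    Matrix.inv_eq_right_inv (by simp [Matrix.diagonal_mul_diagonal, hh])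
  rw [hinv, Matrix.mul_diagonal, Matrix.diagonal_mul]

theorem stmt0 (A B : Fin 3 → ℝ × ℝ) (C : ℝ × ℝ)
    (hsum : A 0 + B 0 = A 1 + B 1 ∧ A 1 + B 1 = A 2 + B 2)
    (hstar : starCond A B C) :
    ∃ F : SU3 ≃ₜ {p : (Fin 3 → ℂ) × (Fin 3 → ℂ) // p ∈ M ∧ Phi A B p = C},
      ∀ g h : Fin 3 → ℂ,
        (∀ i, ‖g i‖ = 1) → g 0 * g 1 * g 2 = 1 →
        (∀ i, ‖h i‖ = 1) → h 0 * h 1 * h 2 = 1 →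
        ∀ (X : SU3)
          (hmem : Matrix.diagonal g * (X : Matrix (Fin 3) (Fin 3) ℂ) *
            (Matrix.diagonal h)⁻¹ ∈ SU3),
          ((F ⟨Matrix.diagonal g * (X : Matrix (Fin 3) (Fin 3) ℂ) *
              (Matrix.diagonal h)⁻¹, hmem⟩ : (Fin 3 → ℂ) × (Fin 3 → ℂ)).1 =
            fun i => g i * (h 0)⁻¹ * ((F X : (Fin 3 → ℂ) × (Fin 3 → ℂ)).1 i)) ∧
          ((F ⟨Matrix.diagonal g * (X : Matrix (Fin 3) (Fin 3) ℂ) *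
              (Matrix.diagonal h)⁻¹, hmem⟩ : (Fin 3 → ℂ) × (Fin 3 → ℂ)).2 =
            fun i => (g i)⁻¹ * h 2 * ((F X : (Fin 3 → ℂ) × (Fin 3 → ℂ)).2 i)) := by
  refine ⟨hstar.homeomorph, fun g h hg _ hh _ X hmem => ?_⟩
  have hh0 (i) : h i ≠ 0 := norm_ne_zero_iff.1 (by rw [hh i]; exact one_ne_zero)
  set Y := Matrix.diagonal g * (X : Matrix (Fin 3) (Fin 3) ℂ) * (Matrix.diagonal h)⁻¹ with hY
  have hstar_eq {c : ℂ} (hc : ‖c‖ = 1) : star c = c⁻¹ := (Complex.inv_eq_conj hc).symm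
  have hcol (i) : firstCol Y i = g i * (h 0)⁻¹ * firstCol X i := by
    rw [firstCol, hY, diagonal_mul_mul_inv_diagonal_apply hh0, firstCol]
    ring
  have hlast (i) : lastColConj Y i = (g i)⁻¹ * h 2 * lastColConj X i := by
    rw [lastColConj, hY, diagonal_mul_mul_inv_diagonal_apply hh0, lastColConj, star_mul', star_mul',
      hstar_eq (hg i), star_inv₀, hstar_eq (hh 2), inv_inv]
    ring
  have hP : weightedSum A (firstCol Y) = weightedSum A (firstCol X) :=
    weightedSum_congr A fun i => by simp [hcol, hg, hh]
  have hQ : weightedSum B (lastColConj Y) = weightedSum B (lastColConj X) :=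
    weightedSum_congr B fun i => by simp [hlast, hg, hh]
  constructor
  · funext i
    change (scaleLeft A B C (firstCol Y) (lastColConj Y) : ℂ) * firstCol Y i =
      _ * (scaleLeft A B C (firstCol X) (lastColConj X) * firstCol X i)
    rw [scaleLeft, hP, hQ, hcol, scaleLeft]
    ring
  · funext i
    change (scaleRight A B C (firstCol Y) (lastColConj Y) : ℂ) * lastColConj Y i =
      _ * (scaleRight A B C (firstCol X) (lastColConj X) * lastColConj X i)
    rw [scaleRight, hP, hQ, hlast, scaleRight]
    ring
end

section
/- Let w₁^L,w₂^L,w₃^L,w₁^R,w₂^R,w₃^R ∈ ℤ² with w₁^L+w₂^L+w₃^L = w₁^R+w₂^R+w₃^R = 0. Put A_j := w_j^L − w₁^R, B_j := −w_j^L + w₃^R for j = 1,2,3 and C := −w₁^R + w₃^R, and assume that A₁,A₂,A₃,B₁,B₂,B₃,C (viewed in ℝ²) satisfy condition (⋆). Then the action of pairs t = (t₁,t₂) of unit complex numbers on SU(3) given by t·A = diag(t^{w₁^L}, t^{w₂^L}, t^{w₃^L}) · A · diag(t^{w₁^R}, t^{w₂^R}, t^{w₃^R})⁻¹ is free if and only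 if w_j^L = 0 for j = 1,2,3 and w₁^R, w₃^R form a ℤ-basis of ℤ². -/
open scoped BigOperators Matrix

/-- `t^w = t₁^{w₁} t₂^{w₂}` for a pair of complex numbers `t` and `w ∈ ℤ²`. -/
noncomputable def tpow (t : ℂ × ℂ) (w : ℤ × ℤ) : ℂ := t.1 ^ w.1 * t.2 ^ w.2

/-- `u, v` form a `ℤ`-basis of `ℤ²` iff the determinant of the matrix with rows `u, v`
is `1` or `-1`. -/
def IsZBasis (u v : ℤ × ℤ) : Prop :=
  u.1 * v.2 - u.2 * v.1 = 1 ∨ u.1 * v.2 - u.2 * v.1 = -1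

/-- The natural inclusion `ℤ² → ℝ²`. -/
def toR (w : ℤ × ℤ) : ℝ × ℝ := ((w.1 : ℝ), (w.2 : ℝ))

/-- The determinant of the `2 × 2` matrix with rows `u` and `v`. -/
def planeDet {R : Type*} [CommRing R] (u v : R × R) : R := u.1 * v.2 - u.2 * v.1

lemma tpow_zero (t : ℂ × ℂ) : tpow t 0 = 1 := by simp [tpow]

lemma tpow_add {t : ℂ × ℂ} (h₁ : t.1 ≠ 0) (h₂ : t.2 ≠ 0) (u v : ℤ × ℤ) :
    tpow t (u + v) = tpow t u * tpow t v := by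
  simp only [tpow, Prod.fst_add, Prod.snd_add, zpow_add₀ h₁, zpow_add₀ h₂]
  ring

lemma tpow_zsmul (t : ℂ × ℂ) (n : ℤ) (u : ℤ × ℤ) : tpow t (n • u) = tpow t u ^ n := by
  simp only [tpow, Prod.smul_fst, Prod.smul_snd, smul_eq_mul, mul_zpow, ← zpow_mul, mul_comm n]

lemma tpow_ne_zero {t : ℂ × ℂ} (h₁ : t.1 ≠ 0) (h₂ : t.2 ≠ 0) (u : ℤ × ℤ) : tpow t u ≠ 0 :=
  mul_ne_zero (zpow_ne_zero _ h₁) (zpow_ne_zero _ h₂)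

lemma tpow_eq_of_tpow_sub_eq_one {t : ℂ × ℂ} (h₁ : t.1 ≠ 0) (h₂ : t.2 ≠ 0) {u v : ℤ × ℤ}
    (h : tpow t (u - v) = 1) : tpow t u = tpow t v := by
  rw [← sub_add_cancel u v, tpow_add h₁ h₂, h, one_mul]

lemma eq_one_of_isZBasis {t : ℂ × ℂ} (h₁ : t.1 ≠ 0) (h₂ : t.2 ≠ 0) {u v : ℤ × ℤ}
    (hu : tpow t u = 1) (hv : tpow t v = 1) (h : IsZBasis u v) : t = (1, 1) := by
  have key (m n : ℤ) : tpow t (m • u + n • v) = 1 := by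
    rw [tpow_add h₁ h₂, tpow_zsmul, tpow_zsmul, hu, hv, one_zpow, one_zpow, one_mul]
  have e₁ : t.1 ^ (u.1 * v.2 - u.2 * v.1) = 1 := by
    rw [← key v.2 (-u.2)]
    have : v.2 • u + (-u.2) • v = (u.1 * v.2 - u.2 * v.1, 0) := by
      ext <;> simp <;> ring
    rw [this]
    simp [tpow]
  have e₂ : t.2 ^ (u.1 * v.2 - u.2 * v.1) = 1 := by
    rw [← key (-v.1) u.1]
    have : (-v.1) • u + u.1 • v = (0, u.1 * v.2 - u.2 * v.1) := by
      ext <;> simp <;> ring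
    rw [this]
    simp [tpow]
  rcases h with h | h <;> rw [h] at e₁ e₂ <;> simp at e₁ e₂ <;> exact Prod.ext e₁ e₂

/-- The pair `(exp (2πi a / D), exp (2πi b / D))`. -/
noncomputable def rootPair (D a b : ℤ) : ℂ × ℂ :=
  (Complex.exp (2 * Real.pi * Complex.I * (a / D)),
    Complex.exp (2 * Real.pi * Complex.I * (b / D)))

lemma norm_exp_two_pi_mul_div (a D : ℤ) :
    ‖Complex.exp (2 * Real.pi * Complex.I * (a / D))‖ = 1 := by
  rw [show (2 * Real.pi * Complex.I * (a / D) : ℂ) = ((2 * Real.pi * (a / D) : ℝ) : ℂ) * Complex.I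
    by push_cast; ring]
  exact Complex.norm_exp_ofReal_mul_I _

lemma exp_two_pi_mul_div_eq_one_iff {a D : ℤ} (hD : D ≠ 0) :
    Complex.exp (2 * Real.pi * Complex.I * (a / D)) = 1 ↔ D ∣ a := by
  have hD' : (D : ℂ) ≠ 0 := by exact_mod_cast hD
  rw [Complex.exp_eq_one_iff]
  have key (n : ℤ) : (2 * Real.pi * Complex.I * (a / D) = n * (2 * Real.pi * Complex.I) : Prop) ↔
      a = D * n := by
    rw [mul_comm (n : ℂ), mul_right_inj' Complex.two_pi_I_ne_zero, div_eq_iff hD', mul_comm]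
    norm_cast
  simp only [key]
  rfl

lemma tpow_rootPair (D a b : ℤ) (w : ℤ × ℤ) :
    tpow (rootPair D a b) w =
      Complex.exp (2 * Real.pi * Complex.I * ((a * w.1 + b * w.2 : ℤ) / D)) := by
  simp only [tpow, rootPair, ← Complex.exp_int_mul, ← Complex.exp_add]
  congr 1
  push_cast
  ring

/-- Vectors `u, v` spanning a sublattice of finite index form a `ℤ`-basis if the annihilator of
that sublattice in the torus is trivial. -/
lemma isZBasis_of_forall_eq_one {u v : ℤ × ℤ} (hD : planeDet u v ≠ 0)
    (h : ∀ t : ℂ × ℂ, ‖t.1‖ = 1 → ‖t.2‖ = 1 → tpow t u = 1 → tpow t v = 1 → t = (1, 1)) :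
    IsZBasis u v := by
  set D := planeDet u v with hDdef
  have key (a b : ℤ) (hu : D ∣ a * u.1 + b * u.2) (hv : D ∣ a * v.1 + b * v.2) :
      D ∣ a ∧ D ∣ b := by
    have := h (rootPair D a b) (norm_exp_two_pi_mul_div _ _) (norm_exp_two_pi_mul_div _ _)
      (by rwa [tpow_rootPair, exp_two_pi_mul_div_eq_one_iff hD])
      (by rwa [tpow_rootPair, exp_two_pi_mul_div_eq_one_iff hD])
    rw [Prod.ext_iff] at this
    exact this.imp (exp_two_pi_mul_div_eq_one_iff hD).1 (exp_two_pi_mul_div_eq_one_iff hD).1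
  obtain ⟨⟨p, hp⟩, ⟨q, hq⟩⟩ := key v.2 (-v.1) ⟨1, by rw [hDdef, planeDet]; ring⟩ ⟨0, by ring⟩
  obtain ⟨⟨r, hr⟩, ⟨s, hs⟩⟩ := key (-u.2) u.1 ⟨0, by ring⟩ ⟨1, by rw [hDdef, planeDet]; ring⟩
  have hunit : D * (s * p - r * q) = 1 := by
    apply mul_left_cancel₀ hD
    calc D * (D * (s * p - r * q)) = (D * s) * (D * p) - (D * r) * (D * q) := by ring
      _ = D * 1 := by rw [← hs, ← hp, ← hr, ← hq, hDdef, planeDet]; ring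
  exact Int.isUnit_iff.1 (IsUnit.of_mul_eq_one _ hunit)

/-- A two-sided diagonal action has a fixed point in `SU(3)` exactly if the diagonal entries agree
up to a permutation. -/
lemma exists_mem_SU3_diagonal_mul_iff (f g : Fin 3 → ℂ) (hg : ∀ j, g j ≠ 0) :
    (∃ A ∈ SU3, Matrix.diagonal f * A * (Matrix.diagonal g)⁻¹ = A) ↔
      ∃ σ : Equiv.Perm (Fin 3), ∀ j, f (σ j) = g j := by
  have hdet : IsUnit (Matrix.diagonal g).det := by
    rw [Matrix.det_diagonal]
    exact (Finset.prod_ne_zero_iff.2 fun j _ => hg j).isUnit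
  constructor
  · rintro ⟨A, hA, hfix⟩
    have hcomm : Matrix.diagonal f * A = A * Matrix.diagonal g := by
      conv_rhs => rw [← hfix, Matrix.nonsing_inv_mul_cancel_right _ _ hdet]
    obtain ⟨σ, -, hσ⟩ : ∃ σ ∈ Finset.univ,
        ((Equiv.Perm.sign σ : ℤ) : ℂ) * ∏ i, A (σ i) i ≠ 0 := by
      apply Finset.exists_ne_zero_of_sum_ne_zero
      rw [← Matrix.det_apply', hA.2]
      exact one_ne_zero
    refine ⟨σ, fun j => ?_⟩
    have hne := Finset.prod_ne_zero_iff.1 (right_ne_zero_of_mul hσ) j (Finset.mem_univ j)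
    have hentry := congrFun₂ hcomm (σ j) j
    rw [Matrix.diagonal_mul, Matrix.mul_diagonal, mul_comm] at hentry
    exact mul_left_cancel₀ hne hentry
  · rintro ⟨σ, hσ⟩
    have hs : ((Equiv.Perm.sign σ : ℤ) : ℂ) * ((Equiv.Perm.sign σ : ℤ) : ℂ) = 1 := by
      exact_mod_cast Int.units_coe_mul_self (Equiv.Perm.sign σ)
    refine ⟨((Equiv.Perm.sign σ : ℤ) : ℂ) • (σ⁻¹).permMatrix ℂ, ⟨?_, ?_⟩, ?_⟩
    · rw [Matrix.conjTranspose_smul, Matrix.conjTranspose_permMatrix, Matrix.smul_mul,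
        Matrix.mul_smul, smul_smul, ← Matrix.permMatrix_mul]
      simp [hs]
    · rw [Matrix.det_smul, Matrix.det_permutation, Equiv.Perm.sign_inv, Fintype.card_fin, pow_succ,
        pow_two, hs, one_mul]
      exact hs
    · rw [Matrix.mul_smul, Matrix.smul_mul]
      congr 1
      suffices Matrix.diagonal f * (σ⁻¹).permMatrix ℂ = (σ⁻¹).permMatrix ℂ * Matrix.diagonal g by
        rw [this, Matrix.mul_nonsing_inv_cancel_right _ _ hdet]
      ext i j
      rw [Matrix.diagonal_mul, Matrix.mul_diagonal, Equiv.Perm.permMatrix, PEquiv.toMatrix_apply]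
      by_cases hij : σ⁻¹ i = j
      · subst hij
        simp [← hσ]
      · simp [show Equiv.symm σ i ≠ j from hij]

/-- Under condition (⋆) with `A j + B j = C`, all pairs `A i, B j` have the same orientation. -/
lemma starCond.planeDet_pos_or_neg {A B : Fin 3 → ℝ × ℝ} {C : ℝ × ℝ} (h : starCond A B C)
    (hAB : ∀ j, A j + B j = C) :
    (∀ i j, 0 < planeDet (A i) (B j)) ∨ (∀ i j, planeDet (A i) (B j) < 0) := by
  obtain ⟨hA, hB, hC⟩ := h
  have hC0 : C ≠ 0 := fun h0 => hA 0 0 ⟨0, 0, le_rfl, le_rfl, by simp [h0]⟩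
  have hAB₁ (j) : (B j).1 = C.1 - (A j).1 := by rw [← hAB j]; simp
  have hAB₂ (j) : (B j).2 = C.2 - (A j).2 := by rw [← hAB j]; simp
  have hne (i) : planeDet (A i) C ≠ 0 := by
    intro h0
    obtain ⟨l, hl⟩ : ∃ l : ℝ, A i = l • C := by
      simp only [planeDet] at h0
      by_cases h1 : C.1 = 0
      · have h2 : C.2 ≠ 0 := fun h2 => hC0 (Prod.ext h1 h2)
        refine ⟨(A i).2 / C.2, Prod.ext ?_ ?_⟩
        · simp only [Prod.smul_fst, smul_eq_mul]; field_simp; linarith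
        · simp only [Prod.smul_snd, smul_eq_mul]; field_simp
      · refine ⟨(A i).1 / C.1, Prod.ext ?_ ?_⟩
        · simp only [Prod.smul_fst, smul_eq_mul]; field_simp
        · simp only [Prod.smul_snd, smul_eq_mul]; field_simp; linarith
    have hl' : B i = (1 - l) • C := by
      rw [sub_smul, one_smul, ← hl]; exact eq_sub_of_add_eq' (hAB i)
    rcases lt_or_ge 0 l with hpos | hnonpos
    · exact hA i i ⟨l⁻¹, 0, by positivity, le_rfl, by
        rw [hl, smul_smul, inv_mul_cancel₀ hpos.ne']; simp⟩
    · have : 0 < 1 - l := by linarith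
      exact hB i i ⟨(1 - l)⁻¹, 0, by positivity, le_rfl, by
        rw [hl', smul_smul, inv_mul_cancel₀ this.ne']; simp⟩
  have hsame (i j) : 0 < planeDet (A i) C * planeDet (A j) C ∧
      0 < planeDet (A i) C * planeDet (A i) (B j) := by
    obtain ⟨a, b, ha, hb, hab⟩ := hC i j
    have h1 : C.1 = a * (A i).1 + b * (B j).1 := by simpa using congrArg Prod.fst hab
    have h2 : C.2 = a * (A i).2 + b * (B j).2 := by simpa using congrArg Prod.snd hab
    have e1 : a * planeDet (A i) C = b * planeDet (A j) C := by
      simp only [planeDet]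
      rw [hAB₁] at h1
      rw [hAB₂] at h2
      linear_combination C.1 * h2 - C.2 * h1
    have e2 : planeDet (A i) C = b * planeDet (A i) (B j) := by
      simp only [planeDet]
      linear_combination (A i).1 * h2 - (A i).2 * h1
    have hi := mul_self_pos.2 (hne i)
    have hj := mul_self_pos.2 (hne j)
    constructor
    · refine lt_of_le_of_ne ?_ (mul_ne_zero (hne i) (hne j)).symm
      by_contra! hlt
      have hb0 : b = 0 := by
        have : a * (planeDet (A i) C * planeDet (A j) C) =
            b * (planeDet (A j) C * planeDet (A j) C) := by
          linear_combination planeDet (A j) C * e1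
        nlinarith
      exact hne i (by rw [e2, hb0, zero_mul])
    · refine pos_of_mul_pos_right (a := b) ?_ hb
      calc 0 < _ := hi
        _ = _ := by linear_combination planeDet (A i) C * e2
  rcases lt_or_gt_of_ne (hne 0) with h0 | h0
  · right
    intro i j
    exact neg_of_mul_pos_right (hsame i j).2 (neg_of_mul_pos_right (hsame 0 i).1 h0.le).le
  · left
    intro i j
    exact pos_of_mul_pos_right (hsame i j).2 (pos_of_mul_pos_right (hsame 0 i).1 h0.le).le

lemma planeDet_toR (u v : ℤ × ℤ) : planeDet (toR u) (toR v) = (planeDet u v : ℤ) := by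
  simp [planeDet, toR]

/-- If all determinants of `A i` and `C - A j` with `i ≠ j` have the same nonzero value, then
the three vectors `A i` coincide. -/
lemma eq_of_planeDet_sub_eq {A : Fin 3 → ℤ × ℤ} {C : ℤ × ℤ} {s : ℤ} (hs : s ≠ 0)
    (h : ∀ i j, i ≠ j → planeDet (A i) (C - A j) = s) (i j : Fin 3) : A i = A j := by
  have hsum (i j) (hij : i ≠ j) : planeDet (A i) C + planeDet (A j) C = 2 * s := by
    have h₁ := h i j hij
    have h₂ := h j i hij.symm
    simp only [planeDet, Prod.fst_sub, Prod.snd_sub] at h₁ h₂ ⊢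
    linear_combination h₁ + h₂
  have hC (i) : planeDet (A i) C = s := by
    have h01 := hsum 0 1 (by decide)
    have h02 := hsum 0 2 (by decide)
    have h12 := hsum 1 2 (by decide)
    fin_cases i <;> simp only [Fin.zero_eta, Fin.mk_one, Fin.reduceFinMk] <;> lia
  rcases eq_or_ne i j with rfl | hij
  · rfl
  have hi := hC i
  have hj := hC j
  have hd := h i j hij
  simp only [planeDet, Prod.fst_sub, Prod.snd_sub] at hi hj hd
  apply Prod.ext <;> apply mul_left_cancel₀ hs
  · linear_combination (A j).1 * hi - (A i).1 * hj + C.1 * (hd - hi)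
  · linear_combination (A j).2 * hi - (A i).2 * hj + C.2 * (hd - hi)

theorem stmt1 (wL wR : Fin 3 → ℤ × ℤ)
    (hL : wL 0 + wL 1 + wL 2 = 0) (hR : wR 0 + wR 1 + wR 2 = 0)
    (hstar : starCond (fun j => toR (wL j - wR 0)) (fun j => toR (-wL j + wR 2))
      (toR (-wR 0 + wR 2))) :
    (∀ t : ℂ × ℂ, ‖t.1‖ = 1 → ‖t.2‖ = 1 →
      ∀ A ∈ SU3,
        Matrix.diagonal (fun j => tpow t (wL j)) * A *
            (Matrix.diagonal (fun j => tpow t (wR j)))⁻¹ = A →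
        t = (1, 1)) ↔
    ((∀ j, wL j = 0) ∧ IsZBasis (wR 0) (wR 2)) := by
  have hne {t : ℂ × ℂ} (h₁ : ‖t.1‖ = 1) (h₂ : ‖t.2‖ = 1) : t.1 ≠ 0 ∧ t.2 ≠ 0 :=
    ⟨norm_ne_zero_iff.1 (by simp [h₁]), norm_ne_zero_iff.1 (by simp [h₂])⟩
  constructor
  · intro hfree
    have hdet := hstar.planeDet_pos_or_neg fun j => by
      simp only [toR, Prod.mk_add_mk, Prod.fst_sub, Prod.fst_add, Prod.snd_sub, Prod.snd_add,
        Prod.fst_neg, Prod.snd_neg]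
      push_cast
      ring_nf
    simp only [planeDet_toR, Int.cast_pos, Int.cast_lt_zero] at hdet
    have hD (i j) : planeDet (wL i - wR 0) (-wL j + wR 2) ≠ 0 :=
      hdet.elim (fun h => (h i j).ne') (fun h => (h i j).ne)
    have hbasis (i j) (hij : i ≠ j) : IsZBasis (wL i - wR 0) (-wL j + wR 2) := by
      refine isZBasis_of_forall_eq_one (hD i j) fun t h₁ h₂ hu hv => ?_
      obtain ⟨ht₁, ht₂⟩ := hne h₁ h₂
      have h0 : tpow t (wL i) = tpow t (wR 0) := tpow_eq_of_tpow_sub_eq_one ht₁ ht₂ hu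
      have h2 : tpow t (wL j) = tpow t (wR 2) :=
        (tpow_eq_of_tpow_sub_eq_one ht₁ ht₂ (by rwa [sub_eq_neg_add])).symm
      have hprodR : tpow t (wR 0) * tpow t (wR 1) * tpow t (wR 2) = 1 := by
        rw [← tpow_add ht₁ ht₂, ← tpow_add ht₁ ht₂, hR, tpow_zero]
      have hprodL : tpow t (wL 0) * tpow t (wL 1) * tpow t (wL 2) = 1 := by
        rw [← tpow_add ht₁ ht₂, ← tpow_add ht₁ ht₂, hL, tpow_zero]
      obtain ⟨σ, rfl, rfl⟩ : ∃ σ : Equiv.Perm (Fin 3), σ 0 = i ∧ σ 2 = j := by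
        clear * - hij
        revert i j
        decide
      have h1 : tpow t (wL (σ 1)) = tpow t (wR 1) := by
        have hperm : tpow t (wL (σ 0)) * tpow t (wL (σ 1)) * tpow t (wL (σ 2)) = 1 := by
          rw [← hprodL, ← Fin.prod_univ_three fun k => tpow t (wL (σ k)),
            Equiv.prod_comp σ fun k => tpow t (wL k), Fin.prod_univ_three]
        rw [h0, h2, ← hprodR] at hperm
        exact mul_left_cancel₀ (tpow_ne_zero ht₁ ht₂ _)
          (mul_right_cancel₀ (tpow_ne_zero ht₁ ht₂ _) hperm)
      obtain ⟨A, hA, hfix⟩ := (exists_mem_SU3_diagonal_mul_iff (fun j => tpow t (wL j))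
        (fun j => tpow t (wR j)) fun j => tpow_ne_zero ht₁ ht₂ _).2
        ⟨σ, Fin.forall_fin_succ.2 ⟨h0, Fin.forall_fin_two.2 ⟨h1, h2⟩⟩⟩
      exact hfree t h₁ h₂ A hA hfix
    obtain ⟨s, hs, hsdet⟩ : ∃ s : ℤ, s ≠ 0 ∧
        ∀ i j, i ≠ j → planeDet (wL i - wR 0) (-wL j + wR 2) = s := by
      rcases hdet with h | h
      · refine ⟨1, one_ne_zero, fun i j hij => (hbasis i j hij).resolve_right fun h' => ?_⟩
        have := h i j
        rw [planeDet, h'] at this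
        lia
      · refine ⟨-1, by decide, fun i j hij => (hbasis i j hij).resolve_left fun h' => ?_⟩
        have := h i j
        rw [planeDet, h'] at this
        lia
    have heq (i j) : wL i = wL j := by
      refine sub_left_injective (eq_of_planeDet_sub_eq (A := fun j => wL j - wR 0)
        (C := wR 2 - wR 0) hs (fun i j hij => ?_) i j)
      rw [← hsdet i j hij]
      congr 1
      abel
    have hzero (j) : wL j = 0 := by
      rw [heq 0 j, heq 1 j, heq 2 j, Prod.ext_iff] at hL
      simp only [Prod.fst_add, Prod.snd_add, Prod.fst_zero, Prod.snd_zero] at hL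
      exact Prod.ext (by rw [Prod.fst_zero]; lia) (by rw [Prod.snd_zero]; lia)
    refine ⟨hzero, ?_⟩
    have := hbasis 0 1 (by decide)
    simp only [hzero, IsZBasis, zero_sub, neg_zero, zero_add, Prod.fst_neg, Prod.snd_neg] at this
    unfold IsZBasis
    lia
  · rintro ⟨hzero, hbasis⟩ t h₁ h₂ A hA hfix
    obtain ⟨ht₁, ht₂⟩ := hne h₁ h₂
    obtain ⟨σ, hσ⟩ := (exists_mem_SU3_diagonal_mul_iff (fun j => tpow t (wL j))
      (fun j => tpow t (wR j)) fun j => tpow_ne_zero ht₁ ht₂ _).1 ⟨A, hA, hfix⟩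
    simp only [hzero, tpow_zero] at hσ
    exact eq_one_of_isZBasis ht₁ ht₂ (hσ 0).symm (hσ 2).symm hbasis
end

section
/- Let A₁,A₂,A₃,B₁,B₂,B₃ ∈ ℝ² with A₁+B₁ = A₂+B₂ = A₃+B₃, and let C ∈ ℝ². If there exist i,j ∈ {1,2,3} with i ≠ j and real numbers a,b > 0 such that C = aA_i + bB_j, then the level set Φ⁻¹(C) is nonempty, i.e., there exists (z,w) ∈ M with Φ(z,w) = C. -/
open scoped BigOperators

theorem stmt4 (A B : Fin 3 → ℝ × ℝ)
    (hsum : A 0 + B 0 = A 1 + B 1 ∧ A 1 + B 1 = A 2 + B 2) (C : ℝ × ℝ)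
    (h : ∃ i j : Fin 3, i ≠ j ∧ ∃ a b : ℝ, 0 < a ∧ 0 < b ∧ C = a • A i + b • B j) :
    ∃ p ∈ M, Phi A B p = C := by
  obtain ⟨i, j, hij, a, b, ha, hb, rfl⟩ := h
  refine ⟨(Pi.single i (√a : ℂ), Pi.single j (√b : ℂ)), ⟨?_, ?_, ?_⟩, ?_⟩
  · simpa using (Real.sqrt_pos.2 ha).ne'
  · simpa using (Real.sqrt_pos.2 hb).ne'
  · refine Finset.sum_eq_zero fun k _ => ?_
    by_cases hk : k = i
    · subst hk
      simp [Pi.single_eq_of_ne hij]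
    · simp [Pi.single_eq_of_ne hk]
  · have norm_sq_single (l k : Fin 3) {c : ℝ} (hc : 0 < c) :
        ‖(Pi.single l (√c : ℂ) : Fin 3 → ℂ) k‖ ^ 2 = if k = l then c else 0 := by
      by_cases hk : k = l
      · subst hk
        simp [Real.sq_sqrt hc.le]
      · simp [hk]
    simp [Phi, norm_sq_single _ _ ha, norm_sq_single _ _ hb, Finset.sum_add_distrib, ite_smul]
end

section
/- Let A₁,A₂,A₃,B₁,B₂,B₃ ∈ ℝ² and assume that A_i and B_j are linearly independent over ℝ whenever i ≠ j. Then for every (z,w) ∈ M and every v ∈ ℝ², if ⟨v, A_j⟩·z_j = 0 for all j = 1,2,3 and ⟨v, B_j⟩·w_j = 0 for all j = 1,2,3 (where ⟨·,·⟩ is the standard inner product on ℝ²), then v = 0. (This states that the two commuting Hamiltonian vector fields generating the torus action are linearly independent at every point of M, which is the content of Proposition 4.2 that every value of Φ is regular.) -/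
open scoped BigOperators

/-- A nonzero pair on the quadric has nonvanishing coordinates at two distinct indices. -/
theorem exists_ne_coord_ne_zero_of_mem_M {p : (Fin 3 → ℂ) × (Fin 3 → ℂ)} (hp : p ∈ M) :
    ∃ i j, i ≠ j ∧ p.1 i ≠ 0 ∧ p.2 j ≠ 0 := by
  obtain ⟨hz, hw, hsum⟩ := hp
  obtain ⟨i, hi⟩ := Function.ne_iff.mp hz
  obtain ⟨k, hk⟩ := Function.ne_iff.mp hw
  by_contra! h
  have hwi : ∀ j, j ≠ i → p.2 j = 0 := fun j hj => h i j hj.symm hi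
  have hki : k = i := by
    by_contra hne
    exact hk (hwi k hne)
  subst hki
  rw [Finset.sum_eq_single k (fun j _ hj => by rw [hwi j hj, mul_zero]) (by simp)] at hsum
  exact mul_ne_zero hi hk hsum

/-- Two linearly independent vectors of the plane have nonzero determinant. -/
theorem det_ne_zero_of_linearIndependent_pair {a b : ℝ × ℝ}
    (h : LinearIndependent ℝ ![a, b]) : a.1 * b.2 - a.2 * b.1 ≠ 0 := by
  rw [LinearIndependent.pair_iff] at h
  intro hD
  have h1 := h b.2 (-a.2) (by ext <;> simp <;> linarith)
  have h2 := h b.1 (-a.1) (by ext <;> simp <;> linarith)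
  have ha : a = 0 := Prod.ext (neg_eq_zero.mp h2.2) (neg_eq_zero.mp h1.2)
  exact one_ne_zero (h 1 0 (by simp [ha])).1

/-- A vector of the plane orthogonal to two linearly independent vectors vanishes. -/
theorem eq_zero_of_orthogonal_linearIndependent_pair {a b v : ℝ × ℝ}
    (h : LinearIndependent ℝ ![a, b]) (ha : v.1 * a.1 + v.2 * a.2 = 0)
    (hb : v.1 * b.1 + v.2 * b.2 = 0) : v = 0 := by
  have hD := det_ne_zero_of_linearIndependent_pair h
  refine Prod.ext (mul_left_cancel₀ hD ?_) (mul_left_cancel₀ hD ?_)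
  · simp only [Prod.fst_zero]
    linear_combination b.2 * ha - a.2 * hb
  · simp only [Prod.snd_zero]
    linear_combination a.1 * hb - b.1 * ha

theorem stmt5 (A B : Fin 3 → ℝ × ℝ)
    (hindep : ∀ i j : Fin 3, i ≠ j → LinearIndependent ℝ ![A i, B j]) :
    ∀ p ∈ M, ∀ v : ℝ × ℝ,
      (∀ j, (v.1 * (A j).1 + v.2 * (A j).2) • p.1 j = 0) →
      (∀ j, (v.1 * (B j).1 + v.2 * (B j).2) • p.2 j = 0) →
      v = 0 := by
  intro p hp v hA hB
  obtain ⟨i, j, hij, hi, hj⟩ := exists_ne_coord_ne_zero_of_mem_M hp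
  exact eq_zero_of_orthogonal_linearIndependent_pair (hindep i j hij)
    ((smul_eq_zero.mp (hA i)).resolve_right hi) ((smul_eq_zero.mp (hB j)).resolve_right hj)
end

section
/- Let A₁,A₂,A₃,B₁,B₂,B₃ ∈ ℝ² with A₁+B₁ = A₂+B₂ = A₃+B₃, and let C ∈ ℝ². Assume: (i) C ∉ cone(A₁,A₂,A₃) and C ∉ cone(B₁,B₂,B₃); (ii) the cone cone(A₁,A₂,A₃,B₁,B₂,B₃) has an apex, i.e., if x and −x both belong to it then x = 0; (iii) A_j ≠ 0 and B_j ≠ 0 for all j. Then the level set Φ⁻¹(C) = {(z,w) ∈ M : Φ(z,w) = C} is a compact subset of ℂ³ × ℂ³. -/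
open scoped BigOperators

/-- The cone spanned by a finite family of vectors in `ℝ²`. -/
def coneFam {n : ℕ} (s : Fin n → ℝ × ℝ) : Set (ℝ × ℝ) :=
  {x | ∃ lam : Fin n → ℝ, (∀ i, 0 ≤ lam i) ∧ x = ∑ i, lam i • s i}

theorem continuous_Phi (A B : Fin 3 → ℝ × ℝ) : Continuous (Phi A B) := by
  unfold Phi
  fun_prop

theorem Phi_smul (A B : Fin 3 → ℝ × ℝ) (t : ℝ) (p : (Fin 3 → ℂ) × (Fin 3 → ℂ)) :
    Phi A B (t • p) = t ^ 2 • Phi A B p := by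
  simp only [Phi, Finset.smul_sum, Prod.smul_fst, Prod.smul_snd, Pi.smul_apply, norm_smul,
    mul_pow, Real.norm_eq_abs, sq_abs, smul_add, smul_smul]

/-- If a conic combination of nonzero vectors spanning a pointed cone vanishes, then all its
coefficients vanish. -/
theorem eq_zero_of_sum_smul_eq_zero {n : ℕ} {s : Fin n → ℝ × ℝ}
    (hs : ∀ x : ℝ × ℝ, x ∈ coneFam s → -x ∈ coneFam s → x = 0) (hne : ∀ i, s i ≠ 0)
    {c : Fin n → ℝ} (hc : ∀ i, 0 ≤ c i) (h : ∑ i, c i • s i = 0) (i : Fin n) : c i = 0 := by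
  have hx : c i • s i = 0 := by
    refine hs _ ⟨fun j => if j = i then c i else 0, fun j => ?_, ?_⟩
      ⟨fun j => if j = i then 0 else c j, fun j => ?_, ?_⟩
    · dsimp only
      split_ifs
      exacts [hc i, le_rfl]
    · simp [ite_smul]
    · dsimp only
      split_ifs
      exacts [le_rfl, hc j]
    · rw [← Finset.add_sum_erase _ _ (Finset.mem_univ i)] at h
      rw [← Finset.add_sum_erase _ _ (Finset.mem_univ i), neg_eq_of_add_eq_zero_right h]
      simp only [if_true, zero_smul, zero_add]
      refine Finset.sum_congr rfl fun j hj => ?_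
      rw [if_neg (Finset.ne_of_mem_erase hj)]
  exact (smul_eq_zero.mp hx).resolve_right (hne i)

theorem eq_zero_of_Phi_eq_zero {A B : Fin 3 → ℝ × ℝ}
    (hapex : ∀ x : ℝ × ℝ, x ∈ coneFam ![A 0, A 1, A 2, B 0, B 1, B 2] →
      -x ∈ coneFam ![A 0, A 1, A 2, B 0, B 1, B 2] → x = 0)
    (hne : ∀ j, A j ≠ 0 ∧ B j ≠ 0) {p : (Fin 3 → ℂ) × (Fin 3 → ℂ)} (hp : Phi A B p = 0) :
    p = 0 := by
  have key := eq_zero_of_sum_smul_eq_zero hapex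
    (by intro i; fin_cases i <;> simp [hne])
    (c := ![‖p.1 0‖ ^ 2, ‖p.1 1‖ ^ 2, ‖p.1 2‖ ^ 2, ‖p.2 0‖ ^ 2, ‖p.2 1‖ ^ 2, ‖p.2 2‖ ^ 2])
    (by intro i; fin_cases i <;> simp)
    (by
      rw [← hp]
      simp only [Phi, Fin.sum_univ_succ, Fin.sum_univ_zero]
      simp
      abel)
  ext j
  · fin_cases j
    exacts [by simpa using key 0, by simpa using key 1, by simpa using key 2]
  · fin_cases j
    exacts [by simpa using key 3, by simpa using key 4, by simpa using key 5]

/-- A continuous map that is homogeneous of degree two and vanishes only at the origin has bounded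
fibres. -/
theorem isBounded_fiber_of_homogeneous {E F : Type*} [NormedAddCommGroup E] [NormedSpace ℝ E]
    [ProperSpace E] [NormedAddCommGroup F] [NormedSpace ℝ F] {f : E → F} (hf : Continuous f)
    (hsmul : ∀ (t : ℝ) (x : E), f (t • x) = t ^ 2 • f x) (hzero : ∀ x, f x = 0 → x = 0) (c : F) :
    Bornology.IsBounded {x | f x = c} := by
  obtain ⟨m, hm, hmf⟩ : ∃ m : ℝ, 0 < m ∧ ∀ x ∈ Metric.sphere (0 : E) 1, m ≤ ‖f x‖ := by
    refine (isCompact_sphere (0 : E) 1).exists_forall_le' hf.norm.continuousOn fun x hx => ?_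
    refine norm_pos_iff.mpr fun h => ?_
    simp [hzero x h] at hx
  refine isBounded_iff_forall_norm_le.mpr ⟨max 1 (‖c‖ / m), fun x hx => ?_⟩
  rw [le_max_iff]
  by_contra! h
  have hx0 : ‖x‖ ≠ 0 := by linarith [h.1]
  have hmx := hmf (‖x‖⁻¹ • x) (by simp [norm_smul, hx0])
  rw [hsmul, hx, norm_smul, norm_pow, norm_inv, norm_norm, inv_pow, le_inv_mul_iff₀ (by positivity)]
    at hmx
  rw [div_lt_iff₀ hm] at h
  nlinarith [mul_pos hm (show 0 < ‖x‖ by linarith [h.1])]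

theorem stmt6 (A B : Fin 3 → ℝ × ℝ)
    (hsum : A 0 + B 0 = A 1 + B 1 ∧ A 1 + B 1 = A 2 + B 2) (C : ℝ × ℝ)
    (hCA : C ∉ coneFam A) (hCB : C ∉ coneFam B)
    (hapex : ∀ x : ℝ × ℝ, x ∈ coneFam ![A 0, A 1, A 2, B 0, B 1, B 2] →
      -x ∈ coneFam ![A 0, A 1, A 2, B 0, B 1, B 2] → x = 0)
    (hne : ∀ j, A j ≠ 0 ∧ B j ≠ 0) :
    IsCompact {p : (Fin 3 → ℂ) × (Fin 3 → ℂ) | p ∈ M ∧ Phi A B p = C} := by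
  have hset : {p : (Fin 3 → ℂ) × (Fin 3 → ℂ) | p ∈ M ∧ Phi A B p = C} =
      {p | ∑ j, p.1 j * p.2 j = 0} ∩ {p | Phi A B p = C} := by
    ext p
    refine ⟨fun h => ⟨h.1.2.2, h.2⟩, fun h => ⟨⟨fun hz => hCB ?_, fun hw => hCA ?_, h.1⟩, h.2⟩⟩
    · exact ⟨fun j => ‖p.2 j‖ ^ 2, fun j => by positivity, by rw [← h.2]; simp [Phi, hz]⟩
    · exact ⟨fun j => ‖p.1 j‖ ^ 2, fun j => by positivity, by rw [← h.2]; simp [Phi, hw]⟩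
  rw [hset]
  refine Metric.isCompact_of_isClosed_isBounded ?_ ?_
  · exact (isClosed_eq (by fun_prop) continuous_const).inter
      (isClosed_eq (continuous_Phi A B) continuous_const)
  · exact (isBounded_fiber_of_homogeneous (continuous_Phi A B) (Phi_smul A B)
      (fun _ => eq_zero_of_Phi_eq_zero hapex hne) C).subset Set.inter_subset_right
end

section
/- The map A ↦ (A·e₁, ᵗA⁻¹·e₃) restricted to SU(3) is a bijection from SU(3) onto the set X₀. (This is the identification of SU(3) with the preimage of (1,1) under (f₁, f₂), where f₁(z,w) = Σ|z_j|² and f₂(z,w) = Σ|w_j|².) -/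
open scoped BigOperators Matrix

/-- The set `X₀ ⊆ ℂ³ × ℂ³`. -/
def X0 : Set ((Fin 3 → ℂ) × (Fin 3 → ℂ)) :=
  {p | ∑ j, ‖p.1 j‖ ^ 2 = 1 ∧ ∑ j, ‖p.2 j‖ ^ 2 = 1 ∧ ∑ j, p.1 j * p.2 j = 0}

open scoped ComplexConjugate

/-- The matrix with columns `z`, `w × z̄`, `w̄`. -/
def frameMatrix (z w : Fin 3 → ℂ) : Matrix (Fin 3) (Fin 3) ℂ :=
  (Matrix.of ![z, w ⨯₃ star z, star w])ᵀ

theorem sum_norm_sq_eq_one_iff (z : Fin 3 → ℂ) :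
    ∑ j, ‖z j‖ ^ 2 = 1 ↔ z 0 * conj (z 0) + z 1 * conj (z 1) + z 2 * conj (z 2) = 1 := by
  simp only [Complex.mul_conj', Fin.sum_univ_three]
  norm_cast

theorem frameMatrix_mem_SU3 {z w : Fin 3 → ℂ} (h : (z, w) ∈ X0) : frameMatrix z w ∈ SU3 := by
  obtain ⟨hz, hw, hzw⟩ := h
  rw [sum_norm_sq_eq_one_iff] at hz hw
  simp only [Fin.sum_univ_three] at hzw
  have hzw' := congrArg conj hzw
  simp only [map_add, map_mul, map_zero] at hzw'
  constructor
  · ext i j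
    fin_cases i <;> fin_cases j <;>
      simp [frameMatrix, Matrix.mul_apply, Fin.sum_univ_three, cross_apply]
    · linear_combination hz
    · ring
    · linear_combination hzw'
    · ring
    · linear_combination
        (w 0 * conj (w 0) + w 1 * conj (w 1) + w 2 * conj (w 2)) * hz + hw
          - (conj (z 0) * conj (w 0) + conj (z 1) * conj (w 1) + conj (z 2) * conj (w 2)) * hzw
    · ring
    · linear_combination hzw
    · ring
    · linear_combination hw
  · simp [frameMatrix, Matrix.det_fin_three, cross_apply]
    linear_combination
      (w 0 * conj (w 0) + w 1 * conj (w 1) + w 2 * conj (w 2)) * hz + hw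
        - (conj (z 0) * conj (w 0) + conj (z 1) * conj (w 1) + conj (z 2) * conj (w 2)) * hzw

theorem inv_eq_conjTranspose_of_mem_SU3 {A : Matrix (Fin 3) (Fin 3) ℂ} (hA : A ∈ SU3) :
    A⁻¹ = A.conjTranspose :=
  Matrix.inv_eq_left_inv hA.1

theorem conjTranspose_eq_adjugate_of_mem_SU3 {A : Matrix (Fin 3) (Fin 3) ℂ} (hA : A ∈ SU3) :
    A.conjTranspose = A.adjugate := by
  rw [← inv_eq_conjTranspose_of_mem_SU3 hA, Matrix.inv_def, hA.2]
  simp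

theorem inv_transpose_mulVec_of_mem_SU3 {A : Matrix (Fin 3) (Fin 3) ℂ} (hA : A ∈ SU3) :
    (A⁻¹)ᵀ.mulVec ![0, 0, 1] = fun i => conj (A i 2) := by
  rw [inv_eq_conjTranspose_of_mem_SU3 hA]
  ext i
  simp [Matrix.mulVec, dotProduct, Fin.sum_univ_three]

theorem mulVec_first_basis (A : Matrix (Fin 3) (Fin 3) ℂ) :
    A.mulVec ![1, 0, 0] = fun i => A i 0 := by
  ext i
  simp [Matrix.mulVec, dotProduct, Fin.sum_univ_three]

theorem frameMatrix_columns_of_mem_SU3 {A : Matrix (Fin 3) (Fin 3) ℂ} (hA : A ∈ SU3) :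
    frameMatrix (fun i => A i 0) (fun i => conj (A i 2)) = A := by
  have h (i : Fin 3) : A i 1 = conj (A.adjugate 1 i) := by
    rw [← conjTranspose_eq_adjugate_of_mem_SU3 hA]
    simp
  ext i j
  fin_cases j
  · simp [frameMatrix]
  · refine Eq.trans ?_ (h i).symm
    fin_cases i <;> simp [frameMatrix, cross_apply, Matrix.adjugate_fin_three] <;> ring
  · simp [frameMatrix]

theorem stmt13 :
    Set.BijOn
      (fun A : Matrix (Fin 3) (Fin 3) ℂ => (A.mulVec ![1, 0, 0], (A⁻¹)ᵀ.mulVec ![0, 0, 1]))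
      SU3 X0 := by
  refine ⟨fun A hA => ?_, fun A hA B hB hAB => ?_, fun ⟨z, w⟩ h => ?_⟩
  · have h (i j : Fin 3) := congrFun (congrFun hA.1 i) j
    simp only [Matrix.mul_apply, Matrix.conjTranspose_apply, Fin.sum_univ_three,
      RCLike.star_def] at h
    simp only [mulVec_first_basis, inv_transpose_mulVec_of_mem_SU3 hA]
    refine ⟨(sum_norm_sq_eq_one_iff _).2 ?_, (sum_norm_sq_eq_one_iff _).2 ?_, ?_⟩
    · have := h 0 0
      simp only [Matrix.one_apply_eq] at this
      linear_combination this
    · have := h 2 2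
      simp only [Matrix.one_apply_eq] at this
      simp only [Complex.conj_conj]
      linear_combination this
    · have := h 2 0
      simp only [Matrix.one_apply_ne (show (2 : Fin 3) ≠ 0 by decide)] at this
      simp only [Fin.sum_univ_three]
      linear_combination this
  · simp only [mulVec_first_basis, inv_transpose_mulVec_of_mem_SU3 hA,
      inv_transpose_mulVec_of_mem_SU3 hB, Prod.mk.injEq] at hAB
    rw [← frameMatrix_columns_of_mem_SU3 hA, ← frameMatrix_columns_of_mem_SU3 hB, hAB.1, hAB.2]
  · have hF := frameMatrix_mem_SU3 h
    refine ⟨frameMatrix z w, hF, ?_⟩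
    simp only [mulVec_first_basis, inv_transpose_mulVec_of_mem_SU3 hF]
    ext i <;> simp [frameMatrix]
end
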